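/- arXiv:math/0611575 — 5 statements merged into one kernel-verified Lean document; each statement's English description precedes it below -/
import Mathlib

section
/- Let G be an infinite group with finite generating set A, and let L be a regular language over the alphabet A ∪ A⁻¹ such that every word in L is a geodesic with respect to A and every element of G is represented by some word in L. If L is accepted by a deterministic finite state automaton with n states, then every element of G has depth at most 2n with respect to A; in particular G has a uniform bound on depth with respect to A. -/
/-- The word length of `g` with respect to a generating set `A`: the least length of a
word in the letters `A ∪ A⁻¹` representing `g`. -/
noncomputable def wordLength {G : Type*} [Group G] (A : Set G) (g : G) : ℕ :=
  sInf {n | ∃ w : List G, w.length = n ∧ (∀ x ∈ w, x ∈ A ∨ x⁻¹ ∈ A) ∧ w.prod = g}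

/-- The word metric with respect to `A`. -/
noncomputable def wordDist {G : Type*} [Group G] (A : Set G) (g h : G) : ℕ :=
  wordLength A (g⁻¹ * h)

/-- A word in the letters `A ∪ A⁻¹` bounds the length of the element it represents. -/
theorem wordLength_prod_le {G : Type*} [Group G] (A : Set G)
    (w : List {x : G // x ∈ A ∨ x⁻¹ ∈ A}) :
    wordLength A (w.map Subtype.val).prod ≤ w.length := by
  refine Nat.sInf_le ⟨w.map Subtype.val, by simp, fun x hx => ?_, rfl⟩
  obtain ⟨y, -, rfl⟩ := List.mem_map.1 hx
  exact y.2

/-- The inverse of the element represented by a word is represented by a word of the same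
length. -/
theorem exists_word_inv {G : Type*} [Group G] {A : Set G}
    (w : List {x : G // x ∈ A ∨ x⁻¹ ∈ A}) :
    ∃ w' : List {x : G // x ∈ A ∨ x⁻¹ ∈ A}, w'.length = w.length ∧
      (w'.map Subtype.val).prod = (w.map Subtype.val).prod⁻¹ := by
  induction w with
  | nil => exact ⟨[], by simp⟩
  | cons a w ih =>
    obtain ⟨w', hlen, hprod⟩ := ih
    exact ⟨w' ++ [⟨a.1⁻¹, by simpa using a.2.symm⟩], by simp [hlen], by
      simp [-List.map_subtype, hprod]⟩

/-- If every element of an infinite group is represented by some word of a language of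
geodesics, then elements of every length exist, and are represented by words of that length. -/
theorem exists_word_wordLength_eq {G : Type*} [Group G] [Infinite G] {A : Set G}
    (hA : A.Finite) {L : Language {x : G // x ∈ A ∨ x⁻¹ ∈ A}}
    (hgeo : ∀ w ∈ L, wordLength A ((w.map Subtype.val).prod) = w.length)
    (hrep : ∀ g : G, ∃ w ∈ L, (w.map Subtype.val).prod = g) (k : ℕ) :
    ∃ w : List {x : G // x ∈ A ∨ x⁻¹ ∈ A},
      w.length = k ∧ wordLength A (w.map Subtype.val).prod = k := by
  obtain ⟨w, hw, hk⟩ : ∃ w ∈ L, k < w.length := by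
    by_contra! hle
    have : Finite {x : G // x ∈ A ∨ x⁻¹ ∈ A} :=
      (hA.union (hA.preimage inv_injective.injOn)).to_subtype
    refine Set.infinite_univ (α := G)
      (((List.finite_length_le {x : G // x ∈ A ∨ x⁻¹ ∈ A} k).image
        fun w => (w.map Subtype.val).prod).subset fun g _ => ?_)
    obtain ⟨w, hw, rfl⟩ := hrep g
    exact ⟨w, hle w hw, rfl⟩
  have hlen : (w.take k).length = k := by simp [hk.le]
  refine ⟨w.take k, hlen, le_antisymm ((wordLength_prod_le A _).trans hlen.le) ?_⟩
  obtain ⟨v, hv, hvp⟩ := hrep ((w.take k).map Subtype.val).prod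
  have hvlen := hgeo v hv
  rw [hvp] at hvlen
  have hle := wordLength_prod_le A (v ++ w.drop k)
  rw [List.map_append, List.prod_append, hvp, ← List.prod_append, ← List.map_append,
    List.take_append_drop, hgeo w hw, List.length_append, List.length_drop] at hle
  omega

/-- If an infinite group `G` has a regular language of geodesics over the alphabet
`A ∪ A⁻¹` (accepted by a DFA with `n` states) representing every element, then every
element of `G` has depth at most `2n` with respect to `A`. -/
theorem stmt0 {G : Type*} [Group G] [Infinite G] (A : Set G) (hA : A.Finite)
    (hgen : Subgroup.closure A = ⊤) {σ : Type*} [Fintype σ] (n : ℕ)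
    (hn : Fintype.card σ = n)
    (M : DFA {x : G // x ∈ A ∨ x⁻¹ ∈ A} σ)
    (hgeo : ∀ w ∈ M.accepts, wordLength A ((w.map Subtype.val).prod) = w.length)
    (hrep : ∀ g : G, ∃ w ∈ M.accepts, (w.map Subtype.val).prod = g) :
    ∀ g : G, ∃ h : G, wordLength A g < wordLength A h ∧ wordDist A g h ≤ 2 * n := by
  intro g
  obtain ⟨w, hw, rfl⟩ := hrep g
  rw [hgeo w hw]
  rcases lt_or_ge w.length n with hlt | hge
  · obtain ⟨v, hvlen, hv⟩ := exists_word_wordLength_eq hA hgeo hrep (w.length + 1)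
    refine ⟨_, by rw [hv]; exact Nat.lt_succ_self _, ?_⟩
    obtain ⟨w', hw'len, hw'⟩ := exists_word_inv w
    have hle := wordLength_prod_le A (w' ++ v)
    rw [List.map_append, List.prod_append, hw', List.length_append] at hle
    unfold wordDist
    omega
  · obtain ⟨u, x, rfl, hx⟩ : ∃ u x, w = u ++ x ∧ x.length = n :=
      ⟨w.take (w.length - n), w.drop (w.length - n), by simp, by simp; omega⟩
    obtain ⟨q, a, b, c, rfl, -, hb, ha, hbq, hc⟩ :=
      M.evalFrom_split (s := M.eval u) (hn.trans hx.symm).le rfl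
    have hpump : u ++ (a ++ b ++ b ++ c) ∈ M.accepts := by
      rw [DFA.mem_accepts, DFA.eval, DFA.evalFrom_of_append] at hw ⊢
      change M.evalFrom (M.eval u) _ ∈ _ at hw
      change M.evalFrom (M.eval u) _ ∈ _
      rw [← hc] at hw
      simpa only [DFA.evalFrom_of_append, ha, hbq] using hw
    have hbpos := List.length_pos_iff.2 hb
    refine ⟨_, by rw [hgeo _ hpump]; simp; omega, ?_⟩
    obtain ⟨c', hc'len, hc'⟩ := exists_word_inv c
    have hle := wordLength_prod_le A (c' ++ b ++ c)
    have hprod : (((u ++ (a ++ b ++ c)).map Subtype.val).prod)⁻¹ *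
        ((u ++ (a ++ b ++ b ++ c)).map Subtype.val).prod =
        ((c' ++ b ++ c).map Subtype.val).prod := by
      simp only [List.map_append, List.prod_append, hc']
      group
    rw [wordDist, hprod]
    simp only [List.length_append] at hle hx
    omega
end

section
/- Let H = ⟨a, b | [a,[a,b]], [b,[a,b]]⟩ be the discrete Heisenberg group, where [x,y] denotes x⁻¹y⁻¹xy. Then H has infinite depth with respect to the generating set {a,b}: for every N there exists an element of H whose depth with respect to {a,b} exceeds N. -/
/-- The commutator `[x,y] = x⁻¹y⁻¹xy`. -/
def comm' {G : Type*} [Group G] (x y : G) : G := x⁻¹ * y⁻¹ * x * y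

/-- The relators of the discrete Heisenberg group `⟨a,b | [a,[a,b]], [b,[a,b]]⟩`. -/
def heisRels : Set (FreeGroup (Fin 2)) :=
  {comm' (FreeGroup.of 0) (comm' (FreeGroup.of 0) (FreeGroup.of 1)),
   comm' (FreeGroup.of 1) (comm' (FreeGroup.of 0) (FreeGroup.of 1))}

/-- The discrete Heisenberg group. -/
abbrev Heis := PresentedGroup heisRels

/-- The generator `a` of the Heisenberg group. -/
def ha : Heis := PresentedGroup.of 0

/-- The generator `b` of the Heisenberg group. -/
def hb : Heis := PresentedGroup.of 1

/-- `g` is the product of a word of length `n` in the letters of `A` and their inverses. -/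
def HasWord {G : Type*} [Group G] (A : Set G) (n : ℕ) (g : G) : Prop :=
  ∃ w : List G, w.length = n ∧ (∀ x ∈ w, x ∈ A ∨ x⁻¹ ∈ A) ∧ w.prod = g

namespace HasWord

variable {G : Type*} [Group G] {A : Set G}

theorem one : HasWord A 0 (1 : G) := ⟨[], by simp⟩

theorem of_mem {g : G} (hg : g ∈ A) : HasWord A 1 g := ⟨[g], by simp [hg]⟩

theorem mul {m n : ℕ} {g h : G} (hg : HasWord A m g) (hh : HasWord A n h) :
    HasWord A (m + n) (g * h) := by
  obtain ⟨v, rfl, hv, rfl⟩ := hg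
  obtain ⟨w, rfl, hw, rfl⟩ := hh
  refine ⟨v ++ w, by simp, fun x hx => ?_, by simp⟩
  rcases List.mem_append.1 hx with h | h
  exacts [hv x h, hw x h]

theorem inv {n : ℕ} {g : G} (hg : HasWord A n g) : HasWord A n g⁻¹ := by
  obtain ⟨w, rfl, hw, rfl⟩ := hg
  refine ⟨(w.map (·⁻¹)).reverse, by simp, fun x hx => ?_, (List.prod_inv_reverse w).symm⟩
  simp only [List.mem_reverse, List.mem_map] at hx
  obtain ⟨y, hy, rfl⟩ := hx
  simpa [or_comm] using hw y hy

theorem pow {g : G} (hg : g ∈ A) (n : ℕ) : HasWord A n (g ^ n) := by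
  induction n with
  | zero => simpa using one
  | succ k ih => simpa [pow_succ] using ih.mul (of_mem hg)

theorem zpow {g : G} (hg : g ∈ A) (k : ℤ) : HasWord A k.natAbs (g ^ k) := by
  obtain ⟨n, rfl | rfl⟩ := k.eq_nat_or_neg
  · simpa using pow hg n
  · simpa using (pow hg n).inv

theorem wordLength_le {n : ℕ} {g : G} (hg : HasWord A n g) : wordLength A g ≤ n :=
  Nat.sInf_le hg

theorem wordLength_spec {n : ℕ} {g : G} (hg : HasWord A n g) :
    HasWord A (wordLength A g) g :=
  Nat.sInf_mem (s := {n | HasWord A n g}) ⟨n, hg⟩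

end HasWord

namespace Heis

theorem exists_hasWord (g : Heis) : ∃ n, HasWord {ha, hb} n g := by
  induction g using PresentedGroup.induction_on with
  | _ z =>
    induction z using FreeGroup.induction_on with
    | C1 => exact ⟨0, HasWord.one⟩
    | of i =>
      refine ⟨1, HasWord.of_mem ?_⟩
      fin_cases i
      · exact Or.inl rfl
      · exact Or.inr rfl
    | inv_of i ih =>
      obtain ⟨n, hn⟩ := ih
      exact ⟨n, hn.inv⟩
    | mul x y hx hy =>
      obtain ⟨m, hm⟩ := hx
      obtain ⟨n, hn⟩ := hy
      exact ⟨m + n, hm.mul hn⟩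

/-- The central commutator `[a,b]`. -/
def hc : Heis := comm' ha hb

theorem commute_of_comm'_eq_one {G : Type*} [Group G] {x y : G} (h : comm' x y = 1) :
    Commute x y := by
  have : (y * x)⁻¹ * (x * y) = 1 := by simpa [comm', mul_assoc] using h
  exact (inv_mul_eq_one.1 this).symm

theorem commute_ha_hc : Commute ha hc :=
  commute_of_comm'_eq_one <|
    PresentedGroup.one_of_mem (rels := heisRels) (Or.inl rfl)

theorem commute_hb_hc : Commute hb hc :=
  commute_of_comm'_eq_one <|
    PresentedGroup.one_of_mem (rels := heisRels) (Or.inr rfl)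

/-- The normal form `b ^ y * a ^ x * c ^ z`. -/
def normal (x y z : ℤ) : Heis := hb ^ y * ha ^ x * hc ^ z

theorem normal_mul_ha_zpow (x y z k : ℤ) : normal x y z * ha ^ k = normal (x + k) y z := by
  have h : hc ^ z * ha ^ k = ha ^ k * hc ^ z := (commute_ha_hc.zpow_zpow k z).symm.eq
  simp only [normal, zpow_add, mul_assoc, h]

theorem ha_zpow_mul_hb (x : ℤ) : ha ^ x * hb = hb * ha ^ x * hc ^ x := by
  have h : hb⁻¹ * ha * hb = ha * hc := by simp [hc, comm', mul_assoc]
  have h' : hb⁻¹ * ha ^ x * hb = ha ^ x * hc ^ x := by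
    rw [← commute_ha_hc.mul_zpow, ← h]
    simpa using (conj_zpow (i := x) (a := hb⁻¹) (b := ha)).symm
  rw [mul_assoc, ← h']
  group

theorem normal_mul_hb (x y z : ℤ) : normal x y z * hb = normal x (y + 1) (z + x) := by
  have h : hc ^ z * hb = hb * hc ^ z := (commute_hb_hc.zpow_right z).symm.eq
  calc normal x y z * hb = hb ^ y * (ha ^ x * hb) * hc ^ z := by
        simp only [normal, mul_assoc, h]
    _ = normal x (y + 1) (z + x) := by
        rw [ha_zpow_mul_hb, normal, add_comm z x, zpow_add, zpow_add, zpow_one]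
        simp only [mul_assoc]

theorem normal_mul_hb_inv (x y z : ℤ) :
    normal x y z * hb⁻¹ = normal x (y - 1) (z - x) := by
  rw [mul_inv_eq_iff_eq_mul, normal_mul_hb]
  simp

theorem normal_mul_hb_zpow (x y z k : ℤ) :
    normal x y z * hb ^ k = normal x (y + k) (z + k * x) := by
  induction k with
  | zero => simp
  | succ n ih =>
    rw [zpow_add_one, ← mul_assoc, ih, normal_mul_hb]
    congr 1 <;> ring
  | pred n ih =>
    rw [zpow_sub_one, ← mul_assoc, ih, normal_mul_hb_inv]
    congr 1 <;> ring

/-- Left multiplication by `a` in normal form coordinates. -/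
def permA : Equiv.Perm (ℤ × ℤ × ℤ) where
  toFun p := (p.1 + 1, p.2.1, p.2.2 + p.2.1)
  invFun p := (p.1 - 1, p.2.1, p.2.2 - p.2.1)
  left_inv p := by simp
  right_inv p := by simp

/-- Left multiplication by `b` in normal form coordinates. -/
def permB : Equiv.Perm (ℤ × ℤ × ℤ) where
  toFun p := (p.1, p.2.1 + 1, p.2.2)
  invFun p := (p.1, p.2.1 - 1, p.2.2)
  left_inv p := by simp
  right_inv p := by simp

/-- Left multiplication by `c` in normal form coordinates. -/
def permC : Equiv.Perm (ℤ × ℤ × ℤ) where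
  toFun p := (p.1, p.2.1, p.2.2 + 1)
  invFun p := (p.1, p.2.1, p.2.2 - 1)
  left_inv p := by simp
  right_inv p := by simp

theorem comm'_permA_permB : comm' permA permB = permC := by
  have h : permA * permB = permB * permA * permC := by
    ext p <;> simp [permA, permB, permC]
    ring
  simp [comm', mul_assoc, h]

theorem comm'_permA_permC : comm' permA permC = 1 := by
  have h : permA * permC = permC * permA := by
    ext p <;> simp [permA, permC]
    ring
  simp [comm', mul_assoc, h]

theorem comm'_permB_permC : comm' permB permC = 1 := by
  have h : permB * permC = permC * permB := by
    ext p <;> simp [permB, permC]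
  simp [comm', mul_assoc, h]

theorem map_comm' {G H : Type*} [Group G] [Group H] (f : G →* H) (x y : G) :
    f (comm' x y) = comm' (f x) (f y) := by
  simp [comm']

theorem lift_eq_one_of_mem_heisRels :
    ∀ r ∈ heisRels, FreeGroup.lift ![permA, permB] r = 1 := by
  rintro r (rfl | rfl)
  · simp [map_comm', comm'_permA_permB, comm'_permA_permC]
  · simp [map_comm', comm'_permA_permB, comm'_permB_permC]

/-- The left regular action on normal form coordinates. -/
def toPerm : Heis →* Equiv.Perm (ℤ × ℤ × ℤ) :=
  PresentedGroup.toGroup lift_eq_one_of_mem_heisRels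

theorem toPerm_ha : toPerm ha = permA := by simp [toPerm, ha]

theorem toPerm_hb : toPerm hb = permB := by simp [toPerm, hb]

theorem toPerm_hc : toPerm hc = permC := by
  rw [hc, map_comm', toPerm_ha, toPerm_hb, comm'_permA_permB]

theorem permA_zpow_apply (k x z : ℤ) : (permA ^ k) (x, 0, z) = (x + k, 0, z) := by
  induction k generalizing x with
  | zero => simp
  | succ n ih =>
    rw [zpow_add_one, Equiv.Perm.mul_apply,
      show permA (x, 0, z) = (x + 1, 0, z) by simp [permA], ih]
    congr 1; ring
  | pred n ih =>
    rw [zpow_sub_one, Equiv.Perm.mul_apply,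
      show permA⁻¹ (x, 0, z) = (x - 1, 0, z) by simp [permA, Equiv.Perm.inv_def], ih]
    congr 1; ring

theorem permB_zpow_apply (k x y z : ℤ) : (permB ^ k) (x, y, z) = (x, y + k, z) := by
  induction k generalizing y with
  | zero => simp
  | succ n ih =>
    rw [zpow_add_one, Equiv.Perm.mul_apply, show permB (x, y, z) = (x, y + 1, z) from rfl, ih]
    congr 2; ring
  | pred n ih =>
    rw [zpow_sub_one, Equiv.Perm.mul_apply, show permB⁻¹ (x, y, z) = (x, y - 1, z) from rfl, ih]
    congr 2; ring

theorem permC_zpow_apply (k x y z : ℤ) : (permC ^ k) (x, y, z) = (x, y, z + k) := by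
  induction k generalizing z with
  | zero => simp
  | succ n ih =>
    rw [zpow_add_one, Equiv.Perm.mul_apply, show permC (x, y, z) = (x, y, z + 1) from rfl, ih]
    congr 2; ring
  | pred n ih =>
    rw [zpow_sub_one, Equiv.Perm.mul_apply, show permC⁻¹ (x, y, z) = (x, y, z - 1) from rfl, ih]
    congr 2; ring

theorem toPerm_normal_apply (x y z : ℤ) : toPerm (normal x y z) (0, 0, 0) = (x, y, z) := by
  simp [normal, toPerm_ha, toPerm_hb, toPerm_hc, permA_zpow_apply, permB_zpow_apply,
    permC_zpow_apply]

theorem normal_inj {x y z x' y' z' : ℤ} (h : normal x y z = normal x' y' z') :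
    x = x' ∧ y = y' ∧ z = z' := by
  have := congrArg (fun g => toPerm g (0, 0, 0)) h
  simpa [toPerm_normal_apply] using this

theorem normal_zero_zero_mul (m x y z : ℤ) :
    normal 0 0 m * normal x y z = normal x y (m + z) := by
  have h := (commute_hb_hc.zpow_zpow y m).eq
  have h' := (commute_ha_hc.zpow_zpow x m).eq
  simp only [normal, zpow_zero, one_mul, zpow_add]
  rw [← mul_assoc, ← mul_assoc, ← h, mul_assoc (hb ^ y), ← h']
  simp only [mul_assoc]

/-- A word of length `A + P + Q`, with `P` letters `b` and `Q` letters `b⁻¹`, traces a path whose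
first coordinate stays in an interval `[m, M]`; this controls the coordinates of its product. -/
theorem exists_normal_of_word (w : List Heis)
    (hw : ∀ g ∈ w, g ∈ ({ha, hb} : Set Heis) ∨ g⁻¹ ∈ ({ha, hb} : Set Heis)) :
    ∃ x y z A P Q M m : ℤ, w.prod = normal x y z ∧ A + P + Q = w.length ∧
      0 ≤ A ∧ 0 ≤ P ∧ 0 ≤ Q ∧ y = P - Q ∧ m ≤ 0 ∧ 0 ≤ M ∧ m ≤ x ∧ x ≤ M ∧
      2 * (M - m) ≤ A + |x| ∧ z ≤ M * P - m * Q ∧ m * P - M * Q ≤ z := by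
  induction w using List.reverseRecOn with
  | nil => exact ⟨0, 0, 0, 0, 0, 0, 0, 0, by simp [normal]⟩
  | append_singleton w g ih =>
    obtain ⟨x, y, z, A, P, Q, M, m, hp, hl, hA, hP, hQ, hy, hm, hM, hmx, hxM, hMm, hz, hz'⟩ :=
      ih fun g hg => hw g (by simp [hg])
    have hg := hw g (by simp)
    simp only [Set.mem_insert_iff, Set.mem_singleton_iff, inv_eq_iff_eq_inv] at hg
    simp only [List.prod_append, List.prod_singleton, hp, List.length_append,
      List.length_singleton, Nat.cast_add, Nat.cast_one]
    rcases hg with (rfl | rfl) | (rfl | rfl)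
    · refine ⟨x + 1, y, z, A + 1, P, Q, max M (x + 1), m,
        by simpa using normal_mul_ha_zpow x y z 1, by lia, by lia, hP, hQ, hy, hm, by lia, by lia,
        by lia, by grind, ?_, ?_⟩
      · nlinarith [le_max_left M (x + 1)]
      · nlinarith [le_max_left M (x + 1)]
    · refine ⟨x, y + 1, z + x, A, P + 1, Q, M, m, normal_mul_hb x y z, by lia, hA, by lia, hQ,
        by lia, hm, hM, hmx, hxM, hMm, by linarith, by linarith⟩
    · refine ⟨x - 1, y, z, A + 1, P, Q, M, min m (x - 1),
        by simpa [sub_eq_add_neg] using normal_mul_ha_zpow x y z (-1), by lia, by lia, hP, hQ, hy,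
        by lia, by lia, by lia, by lia, by grind, ?_, ?_⟩
      · nlinarith [min_le_left m (x - 1)]
      · nlinarith [min_le_left m (x - 1)]
    · refine ⟨x, y - 1, z - x, A, P, Q + 1, M, m, normal_mul_hb_inv x y z, by lia, hA, hP, by lia,
        by lia, hm, hM, hmx, hxM, hMm, by linarith, by linarith⟩

theorem exists_normal_of_hasWord {n : ℕ} {g : Heis} (hg : HasWord {ha, hb} n g) :
    ∃ x y z : ℤ, g = normal x y z ∧ |x| ≤ n ∧ |y| ≤ n ∧ |z| ≤ (n : ℤ) ^ 2 := by
  obtain ⟨w, rfl, hw, rfl⟩ := hg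
  obtain ⟨x, y, z, A, P, Q, M, m, hp, hl, hA, hP, hQ, hy, hm, hM, hmx, hxM, hMm, hz, hz'⟩ :=
    exists_normal_of_word w hw
  have hx : |x| ≤ M - m := abs_le.2 ⟨by lia, by lia⟩
  have hwidth : (M - m) * (P + Q) ≤ (w.length : ℤ) ^ 2 := by
    rw [sq]
    exact mul_le_mul (by lia) (by lia) (by lia) (by lia)
  refine ⟨x, y, z, hp, by lia, by grind, abs_le.2 ⟨?_, ?_⟩⟩ <;>
    nlinarith [mul_nonneg hM hP, mul_nonneg hM hQ, mul_nonneg (neg_nonneg.2 hm) hP,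
      mul_nonneg (neg_nonneg.2 hm) hQ]

/-- The isoperimetric inequality for words representing central elements. -/
theorem sixteen_mul_le_sq_of_hasWord {n : ℕ} {z : ℤ}
    (h : HasWord {ha, hb} n (normal 0 0 z)) : 16 * z ≤ (n : ℤ) ^ 2 := by
  obtain ⟨w, rfl, hw, hprod⟩ := h
  obtain ⟨x, y, z', A, P, Q, M, m, hp, hl, hA, hP, hQ, hy, hm, hM, hmx, hxM, hMm, hz, hz'⟩ :=
    exists_normal_of_word w hw
  obtain ⟨rfl, rfl, rfl⟩ := normal_inj (hprod.symm.trans hp)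
  obtain rfl : P = Q := by lia
  rw [← hl]
  simp only [abs_zero, add_zero] at hMm
  nlinarith [mul_le_mul_of_nonneg_right hMm hP, sq_nonneg (A - 2 * P)]

theorem hasWord_normal_add_left {n : ℕ} {x y z : ℤ} (h : HasWord {ha, hb} n (normal x y z))
    (k : ℤ) : HasWord {ha, hb} (n + k.natAbs) (normal (x + k) y z) := by
  simpa [normal_mul_ha_zpow] using h.mul (HasWord.zpow (g := ha) (by simp) k)

theorem hasWord_normal_add_right {n : ℕ} {x y z : ℤ} (h : HasWord {ha, hb} n (normal x y z))
    (k : ℤ) : HasWord {ha, hb} (n + k.natAbs) (normal x (y + k) (z + k * x)) := by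
  simpa [normal_mul_hb_zpow] using h.mul (HasWord.zpow (g := hb) (by simp) k)

theorem hasWord_normal_zero : HasWord {ha, hb} 0 (normal 0 0 0) := by
  simpa [normal] using HasWord.one

/-- Going around an `n × n` square with a dent of area `j` in one side reaches every point close
to the origin in at most `4 * n` steps. -/
theorem wordLength_normal_le {n : ℕ} {x y j : ℤ} (hn : 0 < n) (hx : |x| ≤ n) (hy : |y| ≤ n)
    (hj : 0 ≤ j) (hjn : j ≤ n) :
    wordLength {ha, hb} (normal x y (n ^ 2 + min (x * y) 0 - j)) ≤ 4 * n := by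
  rw [abs_le] at hx hy
  rcases le_total 0 x with hx0 | hx0 <;> rcases le_total 0 y with hy0 | hy0
  · have h := hasWord_normal_add_left (hasWord_normal_add_right (hasWord_normal_add_left
      (hasWord_normal_add_right (hasWord_normal_add_left (hasWord_normal_add_right
      hasWord_normal_zero (y - n)) (n - 1)) j) 1) (n - j)) (x - n)
    rw [min_eq_right (mul_nonneg hx0 hy0)]
    refine le_trans (le_of_eq_of_le ?_ h.wordLength_le) (by lia)
    congr 2 <;> ring
  · have h := hasWord_normal_add_right (hasWord_normal_add_left (hasWord_normal_add_right
      (hasWord_normal_add_left (hasWord_normal_add_right (hasWord_normal_add_left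
      hasWord_normal_zero (x - n)) (j - n)) 1) (-j)) (n - 1)) (n + y)
    rw [min_eq_left (mul_nonpos_of_nonneg_of_nonpos hx0 hy0)]
    refine le_trans (le_of_eq_of_le ?_ h.wordLength_le) (by lia)
    congr 2 <;> ring
  · have h := hasWord_normal_add_right (hasWord_normal_add_left (hasWord_normal_add_right
      (hasWord_normal_add_left (hasWord_normal_add_right (hasWord_normal_add_left
      hasWord_normal_zero (n + x)) (n - j)) (-1)) j) (1 - n)) (y - n)
    rw [min_eq_left (mul_nonpos_of_nonpos_of_nonneg hx0 hy0)]
    refine le_trans (le_of_eq_of_le ?_ h.wordLength_le) (by lia)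
    congr 2 <;> ring
  · have h := hasWord_normal_add_left (hasWord_normal_add_right (hasWord_normal_add_left
      (hasWord_normal_add_right (hasWord_normal_add_left (hasWord_normal_add_right
      hasWord_normal_zero (n + y)) (1 - n)) (-j)) (-1)) (j - n)) (n + x)
    rw [min_eq_right (mul_nonneg_of_nonpos_of_nonpos hx0 hy0)]
    refine le_trans (le_of_eq_of_le ?_ h.wordLength_le) (by lia)
    congr 2 <;> ring

end Heis

open Heis in
/-- The discrete Heisenberg group has infinite depth with respect to `{a,b}`:
for every `N` there is an element whose depth exceeds `N`. -/
theorem stmt2 : ∀ N : ℕ, ∃ g : Heis, ∀ h : Heis,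
    wordLength {ha, hb} g < wordLength {ha, hb} h →
    N < wordDist {ha, hb} g h := by
  intro N
  obtain ⟨n, hn⟩ : ∃ n : ℕ, n = 4 * N ^ 2 + 1 := ⟨_, rfl⟩
  have hn' : (n : ℤ) = 4 * (N : ℤ) ^ 2 + 1 := by exact_mod_cast hn
  refine ⟨normal 0 0 (n ^ 2 - 2 * N ^ 2), fun h hlt => ?_⟩
  set g := normal 0 0 (n ^ 2 - 2 * N ^ 2) with hg
  by_contra! hle
  have hge : 4 * n ≤ wordLength {ha, hb} g := by
    obtain ⟨_, hw⟩ := exists_hasWord g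
    have := sixteen_mul_le_sq_of_hasWord hw.wordLength_spec
    by_contra! hlt'
    zify at hlt'
    nlinarith
  obtain ⟨_, hw⟩ := exists_hasWord (g⁻¹ * h)
  obtain ⟨x, y, z, hk, hx, hy, hz⟩ := exists_normal_of_hasWord hw.wordLength_spec
  have hD : (wordLength {ha, hb} (g⁻¹ * h) : ℤ) ≤ N := by exact_mod_cast hle
  have hxN := hx.trans hD
  have hyN := hy.trans hD
  have hzN : |z| ≤ (N : ℤ) ^ 2 := hz.trans (by gcongr)
  have hxy : |x * y| ≤ (N : ℤ) ^ 2 := by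
    rw [abs_mul, sq]
    gcongr
  have hNn : (N : ℤ) ≤ n := by nlinarith
  rw [abs_le] at hzN hxy
  have hub := wordLength_normal_le (n := n) (x := x) (y := y)
    (j := 2 * N ^ 2 + min (x * y) 0 - z) (by lia) (by lia) (by lia) (by grind) (by grind)
  have hh : h = normal x y (n ^ 2 + min (x * y) 0 - (2 * N ^ 2 + min (x * y) 0 - z)) := by
    rw [← mul_inv_cancel_left g h, hk, hg, normal_zero_zero_mul]
    congr 1
    ring
  rw [← hh] at hub
  lia
end

section
/- Let (A, a₀, d) be a pointed metric space with deep pockets. Let C be a real number and let d' be an integer-valued metric on A such that |d'(a₁,a₂) − d(a₁,a₂)| < C for all a₁, a₂ ∈ A. Then the pointed metric space (A, a₀, d') also has deep pockets. -/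
/-- If a pointed metric space `(A, a₀, dist)` has deep pockets and `d'` is an
integer-valued metric on `A` differing from `dist` by less than `C`, then
`(A, a₀, d')` also has deep pockets. -/
theorem stmt5 {A : Type*} [MetricSpace A] (a₀ : A)
    (hdeep : ∀ N : ℝ, ∃ a : A, ∀ b : A, dist a₀ a < dist a₀ b → N ≤ dist a b)
    (C : ℝ) (d' : A → A → ℤ)
    (hsymm : ∀ x y, d' x y = d' y x)
    (hself : ∀ x, d' x x = 0)
    (heq : ∀ x y, d' x y = 0 → x = y)
    (htri : ∀ x y z, d' x z ≤ d' x y + d' y z)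
    (hclose : ∀ x y, |(d' x y : ℝ) - dist x y| < C) :
    ∀ N : ℤ, ∃ a : A, ∀ b : A, d' a₀ a < d' a₀ b → N ≤ d' a b := by
  by_contra! ⟨N, hN⟩
  have chain : ∀ (a : A) (k : ℕ), ∃ b, d' a₀ a + k ≤ d' a₀ b ∧ d' a b ≤ k * N := by
    intro a k
    induction k with
    | zero => exact ⟨a, by simp, by simp [hself]⟩
    | succ k ih =>
      obtain ⟨b, hb, hab⟩ := ih
      obtain ⟨c, hc, hbc⟩ := hN b
      refine ⟨c, ?_, ?_⟩
      · push_cast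
        linarith
      · push_cast
        linarith [htri a b c]
  obtain ⟨k, hk⟩ := exists_nat_ge (2 * C)
  obtain ⟨a, ha⟩ := hdeep (k * N + C)
  obtain ⟨b, hb, hab⟩ := chain a k
  have hb' : (d' a₀ a : ℝ) + k ≤ d' a₀ b := by exact_mod_cast hb
  have hab' : (d' a b : ℝ) ≤ k * N := by exact_mod_cast hab
  have h₁ := abs_lt.mp (hclose a₀ a)
  have h₂ := abs_lt.mp (hclose a₀ b)
  have h₃ := abs_lt.mp (hclose a b)
  linarith [ha b (by linarith)]
end

section
/- Let H = ⟨a, b | [a,[a,b]], [b,[a,b]]⟩ be the discrete Heisenberg group, where [x,y] = x⁻¹y⁻¹xy, with word metric d with respect to {a,b}. Then for every integer n ≥ 1, the element [a,b]^{n²+1} is at distance exactly 4n+2 from the identity. -/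
/-- The permutation of `ℤ³` by which the generator `a` acts. -/
def heisPermA : Equiv.Perm (ℤ × ℤ × ℤ) where
  toFun v := (v.1 + 1, v.2.1, v.2.2)
  invFun v := (v.1 - 1, v.2.1, v.2.2)
  left_inv v := by ext <;> simp
  right_inv v := by ext <;> simp

/-- The permutation of `ℤ³` by which the generator `b` acts. -/
def heisPermB : Equiv.Perm (ℤ × ℤ × ℤ) where
  toFun v := (v.1, v.2.1 + 1, v.2.2 - v.1)
  invFun v := (v.1, v.2.1 - 1, v.2.2 + v.1)
  left_inv v := by ext <;> simp
  right_inv v := by ext <;> simp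

theorem heisPermA_apply (v : ℤ × ℤ × ℤ) : heisPermA v = (v.1 + 1, v.2.1, v.2.2) := rfl

theorem heisPermA_inv_apply (v : ℤ × ℤ × ℤ) : heisPermA⁻¹ v = (v.1 - 1, v.2.1, v.2.2) := rfl

theorem heisPermB_apply (v : ℤ × ℤ × ℤ) : heisPermB v = (v.1, v.2.1 + 1, v.2.2 - v.1) := rfl

theorem heisPermB_inv_apply (v : ℤ × ℤ × ℤ) :
    heisPermB⁻¹ v = (v.1, v.2.1 - 1, v.2.2 + v.1) := rfl

theorem comm'_heisPerm_apply (v : ℤ × ℤ × ℤ) :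
    comm' heisPermA heisPermB v = (v.1, v.2.1, v.2.2 + 1) := by
  simp only [comm', Equiv.Perm.mul_apply, heisPermA_apply, heisPermA_inv_apply,
    heisPermB_apply, heisPermB_inv_apply]
  ext <;> simp only <;> ring

theorem comm'_eq_one {G : Type*} [Group G] {x y : G} (h : Commute x y) : comm' x y = 1 := by
  rw [comm', mul_assoc, h.eq]
  group

theorem commute_of_comm'_eq_one {G : Type*} [Group G] {x y : G} (h : comm' x y = 1) :
    Commute x y := by
  have h' : (y * x)⁻¹ * (x * y) = 1 := by
    rw [← h, comm']
    group
  exact (inv_mul_eq_one.mp h').symm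

theorem map_comm' {G K : Type*} [Group G] [Group K] (f : G →* K) (x y : G) :
    f (comm' x y) = comm' (f x) (f y) := by
  simp [comm']

/-- The action of the Heisenberg group on `ℤ³`. -/
def heisAction : Heis →* Equiv.Perm (ℤ × ℤ × ℤ) :=
  PresentedGroup.toGroup (f := ![heisPermA, heisPermB]) (by
    have hA : Commute heisPermA (comm' heisPermA heisPermB) := by
      ext v : 1
      simp [comm'_heisPerm_apply, heisPermA_apply]
    have hB : Commute heisPermB (comm' heisPermA heisPermB) := by
      ext v : 1
      simp [comm'_heisPerm_apply, heisPermB_apply]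
      ring
    rintro r (rfl | rfl) <;> simp only [map_comm', FreeGroup.lift_apply_of]
    exacts [comm'_eq_one hA, comm'_eq_one hB])

theorem heisAction_ha : heisAction ha = heisPermA := PresentedGroup.toGroup.of _

theorem heisAction_hb : heisAction hb = heisPermB := PresentedGroup.toGroup.of _

theorem heisAction_comm'_pow_apply (k : ℕ) (v : ℤ × ℤ × ℤ) :
    heisAction (comm' ha hb ^ k) v = (v.1, v.2.1, v.2.2 + k) := by
  induction k with
  | zero => simp
  | succ k ih =>
    rw [pow_succ', map_mul, Equiv.Perm.mul_apply, ih, map_comm', heisAction_ha, heisAction_hb,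
      comm'_heisPerm_apply]
    push_cast
    ext <;> simp only
    ring

/-- A word with `p` letters `a^{±1}`, `r` letters `b` and `s` letters `b⁻¹`, all of whose
suffixes have first coordinate in `[m, M]`. -/
theorem exists_bounds_of_word (w : List Heis)
    (hw : ∀ x ∈ w, x ∈ ({ha, hb} : Set Heis) ∨ x⁻¹ ∈ ({ha, hb} : Set Heis)) :
    ∃ m M p r s : ℤ, m ≤ 0 ∧ 0 ≤ M ∧ 0 ≤ p ∧ 0 ≤ r ∧ 0 ≤ s ∧
      (w.length : ℤ) = p + r + s ∧
      m ≤ (heisAction w.prod 0).1 ∧ (heisAction w.prod 0).1 ≤ M ∧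
      2 * (M - m) ≤ p + |(heisAction w.prod 0).1| ∧
      (∃ t, p = (heisAction w.prod 0).1 + 2 * t) ∧
      (heisAction w.prod 0).2.1 = r - s ∧
      (heisAction w.prod 0).2.2 ≤ s * M - r * m := by
  induction w with
  | nil => exact ⟨0, 0, 0, 0, 0, by simp⟩
  | cons g w ih =>
    obtain ⟨m, M, p, r, s, hm, hM, hp, hr, hs, hl, h₁, h₂, h₃, ⟨t, ht⟩, hy, hz⟩ :=
      ih fun x hx => hw x (List.mem_cons_of_mem _ hx)
    simp only [List.prod_cons, map_mul, Equiv.Perm.mul_apply, List.length_cons, Nat.cast_succ]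
    generalize heisAction w.prod 0 = v at *
    obtain ⟨x, y, z⟩ := v
    dsimp only at *
    have hg : g = ha ∨ g = hb ∨ g = ha⁻¹ ∨ g = hb⁻¹ := by
      have := hw g List.mem_cons_self
      simp only [Set.mem_insert_iff, Set.mem_singleton_iff, inv_eq_iff_eq_inv] at this
      tauto
    rcases hg with rfl | rfl | rfl | rfl
    · rw [heisAction_ha, heisPermA_apply]
      refine ⟨m, max M (x + 1), p + 1, r, s, hm, by omega, by omega, hr, hs, by omega,
        by dsimp only; omega, by dsimp only; omega, by dsimp only; grind,
        ⟨t, by dsimp only; omega⟩, hy, hz.trans ?_⟩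
      gcongr
      exact le_max_left _ _
    · rw [heisAction_hb, heisPermB_apply]
      exact ⟨m, M, p, r + 1, s, hm, hM, hp, by omega, hs, by omega, h₁, h₂, h₃, ⟨t, ht⟩,
        by dsimp only; omega, by dsimp only; linarith⟩
    · rw [map_inv, heisAction_ha, heisPermA_inv_apply]
      refine ⟨min m (x - 1), M, p + 1, r, s, by omega, hM, by omega, hr, hs, by omega,
        by dsimp only; omega, by dsimp only; omega, by dsimp only; grind,
        ⟨t + 1, by dsimp only; omega⟩, hy, hz.trans ?_⟩
      gcongr
      exact min_le_left _ _
    · rw [map_inv, heisAction_hb, heisPermB_inv_apply]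
      exact ⟨m, M, p, r, s + 1, hm, hM, hp, hr, by omega, by omega, h₁, h₂, h₃, ⟨t, ht⟩,
        by dsimp only; omega, by dsimp only; linarith⟩

/-- A word representing `[a,b]^{n²+1}` has length at least `4n+2`. -/
theorem le_length_of_prod_eq (n : ℕ) (w : List Heis)
    (hw : ∀ x ∈ w, x ∈ ({ha, hb} : Set Heis) ∨ x⁻¹ ∈ ({ha, hb} : Set Heis))
    (h : w.prod = comm' ha hb ^ (n ^ 2 + 1)) : 4 * n + 2 ≤ w.length := by
  obtain ⟨m, M, p, r, s, hm, hM, hp, hr, hs, hl, -, -, h₃, ⟨t, ht⟩, hy, hz⟩ :=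
    exists_bounds_of_word w hw
  rw [h, heisAction_comm'_pow_apply] at h₃ ht hy hz
  simp only [Prod.fst_zero, Prod.snd_zero, abs_zero, add_zero, zero_add] at h₃ ht hy hz
  push_cast at hz
  obtain rfl : s = r := by omega
  have hpos : (n : ℤ) ^ 2 + 1 ≤ s * t := by nlinarith
  have hlt : 2 * (n : ℤ) < s + t := by
    by_contra! hle
    nlinarith [sq_nonneg (s - t)]
  omega

theorem commute_ha_comm' : Commute ha (comm' ha hb) := by
  apply commute_of_comm'_eq_one
  have := PresentedGroup.one_of_mem (rels := heisRels) (Set.mem_insert _ _)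
  simp only [map_comm'] at this
  exact this

theorem commute_hb_comm' : Commute hb (comm' ha hb) := by
  apply commute_of_comm'_eq_one
  have := PresentedGroup.one_of_mem (rels := heisRels) (Set.mem_insert_of_mem _ rfl)
  simp only [map_comm'] at this
  exact this

theorem ha_mul_hb : ha * hb = hb * ha * comm' ha hb := by
  rw [comm']
  group

theorem ha_mul_hb_pow (j : ℕ) : ha * hb ^ j = hb ^ j * ha * comm' ha hb ^ j := by
  induction j with
  | zero => simp
  | succ j ih =>
    rw [pow_succ, ← mul_assoc, ih, mul_assoc, ← (commute_hb_comm'.pow_right j).eq, ← mul_assoc,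
      mul_assoc (hb ^ j), ha_mul_hb, pow_succ' (comm' ha hb)]
    simp only [mul_assoc]

theorem ha_pow_mul_hb_pow (i j : ℕ) :
    ha ^ i * hb ^ j = hb ^ j * ha ^ i * comm' ha hb ^ (i * j) := by
  induction i with
  | zero => simp
  | succ i ih =>
    rw [pow_succ', mul_assoc, ih, ← mul_assoc, ← mul_assoc, ha_mul_hb_pow, mul_assoc (hb ^ j * ha),
      ((commute_ha_comm'.pow_pow i j).eq).symm, add_mul, one_mul, add_comm, pow_add]
    simp only [mul_assoc]

/-- The element `[a,b]^{n²+1}` is represented by the boundary word of an `n × n` square with one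
extra unit cell. -/
theorem boundary_word_prod (n : ℕ) (hn : 1 ≤ n) :
    ha⁻¹ ^ (n - 1) * (hb * (ha⁻¹ * (hb⁻¹ * (hb⁻¹ ^ n * (ha ^ n * hb ^ n))))) =
      comm' ha hb ^ (n ^ 2 + 1) := by
  obtain ⟨k, rfl⟩ := Nat.exists_eq_add_of_le' hn
  have hcell : hb * ha⁻¹ * hb⁻¹ = ha⁻¹ * comm' ha hb := by
    rw [mul_inv_eq_iff_eq_mul, mul_assoc, eq_inv_mul_iff_mul_eq, ← mul_assoc,
      mul_inv_eq_iff_eq_mul, ha_mul_hb, mul_assoc (comm' ha hb)]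
    exact (commute_hb_comm'.mul_left commute_ha_comm').eq
  calc
    _ = (ha ^ k)⁻¹ * (hb * ha⁻¹ * hb⁻¹) * ha ^ (k + 1) * comm' ha hb ^ (k + 1) ^ 2 := by
      rw [ha_pow_mul_hb_pow, ← sq]
      simp [mul_assoc]
    _ = (ha ^ k)⁻¹ * (ha⁻¹ * (ha ^ (k + 1) * comm' ha hb)) * comm' ha hb ^ (k + 1) ^ 2 := by
      rw [hcell, (commute_ha_comm'.pow_left (k + 1)).eq]
      simp only [mul_assoc]
    _ = _ := by
      rw [pow_succ' ha, pow_succ' (comm' ha hb)]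
      simp [mul_assoc]

/-- In the discrete Heisenberg group, `[a,b]^{n²+1}` is at distance exactly `4n+2`
from the identity, for every `n ≥ 1`. -/
theorem stmt10 (n : ℕ) (hn : 1 ≤ n) :
    wordLength {ha, hb} ((comm' ha hb) ^ (n ^ 2 + 1)) = 4 * n + 2 := by
  have hmem : 4 * n + 2 ∈ {k | ∃ w : List Heis, w.length = k ∧
      (∀ x ∈ w, x ∈ ({ha, hb} : Set Heis) ∨ x⁻¹ ∈ ({ha, hb} : Set Heis)) ∧
      w.prod = comm' ha hb ^ (n ^ 2 + 1)} := by
    refine ⟨List.replicate (n - 1) ha⁻¹ ++ hb :: ha⁻¹ :: hb⁻¹ :: (List.replicate n hb⁻¹ ++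
      (List.replicate n ha ++ List.replicate n hb)), ?_, ?_, ?_⟩
    · simp only [List.length_append, List.length_cons, List.length_replicate]
      omega
    · intro x hx
      simp only [List.mem_append, List.mem_cons, List.mem_replicate] at hx
      rcases hx with ⟨-, rfl⟩ | rfl | rfl | rfl | ⟨-, rfl⟩ | ⟨-, rfl⟩ | ⟨-, rfl⟩ <;> simp
    · simpa only [List.prod_append, List.prod_cons, List.prod_replicate]
        using boundary_word_prod n hn
  refine le_antisymm (Nat.sInf_le hmem) (le_csInf ⟨_, hmem⟩ ?_)
  rintro _ ⟨w, rfl, hw, h⟩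
  exact le_length_of_prod_eq n w hw h
end

section
/- Let H = ⟨a, b | [a,[a,b]], [b,[a,b]]⟩ be the discrete Heisenberg group, where [x,y] = x⁻¹y⁻¹xy, with word metric d with respect to {a,b}. Let n ≥ 1 and m ≥ 0 be integers. Then every element h of H with d([a,b]^{n²+1}, h) ≤ m can be written as h = a^i b^j [a,b]^k with |i| ≤ m, |j| ≤ m and |k| ≤ n² + 1 + m(m−1)/2. -/
section NormalForm

variable {G : Type*} [Group G] {a b : G}

theorem comm'_eq_one_iff_commute (x y : G) : comm' x y = 1 ↔ Commute x y := by
  rw [comm', mul_assoc, mul_eq_one_iff_inv_eq, mul_inv_rev, inv_inv, inv_inv]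
  exact eq_comm

/-- Moving a power of `b` past `a` produces a power of the central commutator. -/
theorem zpow_mul_of_commute_comm' (hbc : Commute b (comm' a b)) (j : ℤ) :
    b ^ j * a = a * b ^ j * comm' a b ^ (-j) := by
  have h1 : SemiconjBy a (b * (comm' a b)⁻¹) b := by
    simp only [SemiconjBy, comm']
    group
  have h2 := h1.zpow_right j
  rw [(hbc.inv_right).mul_zpow, inv_zpow, ← zpow_neg] at h2
  rw [← h2.eq, mul_assoc]

theorem zpow_mul_inv_of_commute_comm' (hac : Commute a (comm' a b))
    (hbc : Commute b (comm' a b)) (j : ℤ) :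
    b ^ j * a⁻¹ = a⁻¹ * b ^ j * comm' a b ^ j := by
  have h := zpow_mul_of_commute_comm' hbc j
  have hc := (hac.zpow_right j).eq
  rw [mul_inv_eq_iff_eq_mul, mul_assoc _ _ a, ← hc, ← mul_assoc, mul_assoc a⁻¹, h]
  simp [mul_assoc]

/-- Right multiplication by a word of length `ℓ` keeps the normal form under control. -/
theorem exists_normal_form_mul_prod (hac : Commute a (comm' a b))
    (hbc : Commute b (comm' a b)) (N : ℤ) (w : List G)
    (hw : ∀ x ∈ w, x ∈ ({a, b} : Set G) ∨ x⁻¹ ∈ ({a, b} : Set G)) :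
    ∃ i j k : ℤ, comm' a b ^ N * w.prod = a ^ i * b ^ j * comm' a b ^ k ∧
      |i| ≤ w.length ∧ |j| ≤ w.length ∧
      |k| ≤ |N| + ((w.length * (w.length - 1) / 2 : ℕ) : ℤ) := by
  induction w using List.reverseRecOn with
  | nil => exact ⟨0, 0, N, by simp⟩
  | append_singleton w x ih =>
    obtain ⟨i, j, k, h, hi, hj, hk⟩ := ih fun y hy => hw y (by simp [hy])
    have hx := hw x (by simp)
    have hlen : (w ++ [x]).length = w.length + 1 := by simp
    rw [hlen, Nat.triangle_succ, List.prod_append, List.prod_singleton, ← mul_assoc, h]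
    simp only [Nat.cast_add, Nat.cast_one]
    rw [abs_le] at hi hj hk
    simp only [abs_le]
    simp only [Set.mem_insert_iff, Set.mem_singleton_iff, inv_eq_iff_eq_inv] at hx
    rcases hx with (rfl | rfl) | (rfl | rfl)
    · refine ⟨i + 1, j, k - j, ?_, by omega, by omega, by omega⟩
      rw [mul_assoc, ← (hac.zpow_right k).eq, ← mul_assoc, mul_assoc (x ^ i),
        zpow_mul_of_commute_comm' hbc, zpow_add_one, sub_eq_neg_add, zpow_add]
      simp only [mul_assoc]
    · refine ⟨i, j + 1, k, ?_, by omega, by omega, by omega⟩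
      rw [mul_assoc, ← (hbc.zpow_right k).eq, zpow_add_one]
      simp only [mul_assoc]
    · refine ⟨i - 1, j, k + j, ?_, by omega, by omega, by omega⟩
      rw [mul_assoc, ← (hac.inv_left.zpow_right k).eq, ← mul_assoc, mul_assoc (a ^ i),
        zpow_mul_inv_of_commute_comm' hac hbc, zpow_sub_one, add_comm k, zpow_add]
      simp only [mul_assoc]
    · refine ⟨i, j - 1, k, ?_, by omega, by omega, by omega⟩
      rw [mul_assoc, ← (hbc.inv_left.zpow_right k).eq, zpow_sub_one]
      simp only [mul_assoc]

end NormalForm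

/-- In a group generated by `A`, the word length is attained by a word. -/
theorem exists_list_length_eq_wordLength {G : Type*} [Group G] {A : Set G}
    (hA : Subgroup.closure A = ⊤) (g : G) :
    ∃ w : List G, w.length = wordLength A g ∧ (∀ x ∈ w, x ∈ A ∨ x⁻¹ ∈ A) ∧ w.prod = g := by
  have hg : g ∈ Subgroup.closure A := hA ▸ Subgroup.mem_top g
  rw [← Subgroup.mem_toSubmonoid, Subgroup.closure_toSubmonoid] at hg
  obtain ⟨w, hw, hprod⟩ := Submonoid.exists_list_of_mem_closure hg
  exact Nat.sInf_mem
    (s := {n | ∃ w : List G, w.length = n ∧ (∀ x ∈ w, x ∈ A ∨ x⁻¹ ∈ A) ∧ w.prod = g})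
    ⟨w.length, w, rfl, hw, hprod⟩

theorem closure_ha_hb : Subgroup.closure ({ha, hb} : Set Heis) = ⊤ := by
  rw [← PresentedGroup.closure_range_of heisRels]
  congr 1
  ext x
  simp [ha, hb, Fin.exists_fin_two, eq_comm]

/-- Every element of the discrete Heisenberg group within distance `m` of
`[a,b]^{n²+1}` is of the form `aⁱbʲ[a,b]ᵏ` with `|i| ≤ m`, `|j| ≤ m` and
`|k| ≤ n² + 1 + m(m−1)/2`. -/
theorem stmt12 (n m : ℕ) (hn : 1 ≤ n) (h : Heis)
    (hd : wordDist {ha, hb} ((comm' ha hb) ^ (n ^ 2 + 1)) h ≤ m) :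
    ∃ i j k : ℤ, h = ha ^ i * hb ^ j * (comm' ha hb) ^ k ∧
      |i| ≤ (m : ℤ) ∧ |j| ≤ (m : ℤ) ∧
      |k| ≤ (n : ℤ) ^ 2 + 1 + ((m * (m - 1) / 2 : ℕ) : ℤ) := by
  obtain ⟨w, hlen, hw, hprod⟩ := exists_list_length_eq_wordLength closure_ha_hb
    ((comm' ha hb ^ (n ^ 2 + 1))⁻¹ * h)
  obtain ⟨i, j, k, hform, hi, hj, hk⟩ := exists_normal_form_mul_prod commute_ha_comm'
    commute_hb_comm' ((n ^ 2 + 1 : ℕ) : ℤ) w hw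
  have hle : w.length ≤ m := hlen.trans_le hd
  rw [hprod, zpow_natCast, mul_inv_cancel_left] at hform
  have hlen_le : (w.length : ℤ) ≤ m := mod_cast hle
  refine ⟨i, j, k, hform, hi.trans hlen_le, hj.trans hlen_le, hk.trans ?_⟩
  rw [Nat.abs_cast]
  rw [Nat.cast_add, Nat.cast_pow, Nat.cast_one]
  gcongr
end
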